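/- Under hypotheses (H0)-(H3), for every t > ρ(P) and every a ∈ Γ₊^t such that either φ₀(ā^t) < t, or a = ā^t ∈ ∂₀D^t, the normal cone to Ĥ^t at a is V_t(a) = {c ∇φ(a) : c ≥ 0}. -/

import Mathlib

open scoped Classical BigOperators
open Filter

noncomputable section

namespace RWHalfspace

/-- `ℤ^d` modeled as `ℤ^{d-1} × ℤ`; the Lean parameter `d` is the paper's `d-1`,
so that the paper's hypothesis `d ≥ 1` is automatic. -/
abbrev Zd (d : ℕ) := (Fin d → ℤ) × ℤ
/-- The state space `E = ℤ^{d-1} × ℕ`. -/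
abbrev Ed (d : ℕ) := (Fin d → ℤ) × ℕ
/-- `ℝ^d` modeled as `ℝ^{d-1} × ℝ`. -/
abbrev Rd (d : ℕ) := (Fin d → ℝ) × ℝ

variable {d : ℕ}

/-- The scalar product `a · z` for `a ∈ ℝ^d`, `z ∈ ℤ^d`. -/
def dotZ (a : Rd d) (z : Zd d) : ℝ := (∑ i, a.1 i * (z.1 i : ℝ)) + a.2 * (z.2 : ℝ)

/-- The scalar product on `ℝ^d`. -/
def dotR (a b : Rd d) : ℝ := (∑ i, a.1 i * b.1 i) + a.2 * b.2

/-- The scalar product `a · z` for `a ∈ ℝ^d`, `z ∈ E = ℤ^{d-1} × ℕ`. -/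
def dotE (a : Rd d) (z : Ed d) : ℝ := (∑ i, a.1 i * (z.1 i : ℝ)) + a.2 * (z.2 : ℝ)

/-- The jump generating function `φ(a) = ∑_{z ∈ ℤ^d} μ(z) e^{a·z}`. -/
def phi (μ : Zd d → ℝ) (a : Rd d) : ℝ := ∑' z, μ z * Real.exp (dotZ a z)

/-- The difference `z' - z ∈ ℤ^d` of two points of `E`. -/
def jump (z z' : Ed d) : Zd d := (z'.1 - z.1, (z'.2 : ℤ) - (z.2 : ℤ))

/-- The transition kernel of the reflected random walk on `E = ℤ^{d-1} × ℕ`. -/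
def ker (μ μ₀ : Zd d → ℝ) (z z' : Ed d) : ℝ :=
  if z.2 = 0 then μ₀ (jump z z') else μ (jump z z')

/-- The `n`-step transition kernel `p^(n)`. -/
def kerN (μ μ₀ : Zd d → ℝ) : ℕ → Ed d → Ed d → ℝ
  | 0 => fun z z' => if z = z' then 1 else 0
  | n + 1 => fun z z' => ∑' w, kerN μ μ₀ n z w * ker μ μ₀ w z'

/-- The `n`-step kernel of the homogeneous random walk on `ℤ^d` with step distribution `μ`. -/
def homN (μ : Zd d → ℝ) : ℕ → Zd d → Zd d → ℝ
  | 0 => fun z z' => if z = z' then 1 else 0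
  | n + 1 => fun z z' => ∑' w, homN μ n z w * μ (z' - w)

/-- The step distribution of the last coordinate of the homogeneous random walk. -/
def lastStep (μ : Zd d → ℝ) (k : ℤ) : ℝ := ∑' x : Fin d → ℤ, μ (x, k)

/-- The `n`-step kernel of the last coordinate random walk on `ℤ`. -/
def lastN (μ : Zd d → ℝ) : ℕ → ℤ → ℤ → ℝ
  | 0 => fun k k' => if k = k' then 1 else 0
  | n + 1 => fun k k' => ∑' j, lastN μ n k j * lastStep μ (k' - j)

/-- The convergence norm `ρ(P) = limsup_n (p^(n)(z,z'))^{1/n}` (independent of `z, z'`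
by irreducibility; we take `z = z' = 0`). -/
def rho (μ μ₀ : Zd d → ℝ) : ℝ :=
  limsup (fun n : ℕ => (kerN μ μ₀ n 0 0) ^ ((n : ℝ)⁻¹)) atTop

/-- `μ` is a nonnegative measure on `ℤ^d` with `0 < μ(ℤ^d) ≤ 1`. -/
def IsMeasure (μ : Zd d → ℝ) : Prop := (∀ z, 0 ≤ μ z) ∧ 0 < ∑' z, μ z ∧ ∑' z, μ z ≤ 1

/-- (H0): `μ(x,y) = 0` for `y < -1` and `μ₀(x,y) = 0` for `y < 0`. -/
def H0 (μ μ₀ : Zd d → ℝ) : Prop :=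
  (∀ z : Zd d, z.2 < -1 → μ z = 0) ∧ (∀ z : Zd d, z.2 < 0 → μ₀ z = 0)

/-- (H1): the kernel `P` is irreducible on `E`. -/
def H1 (μ μ₀ : Zd d → ℝ) : Prop := ∀ z z' : Ed d, ∃ n, 0 < kerN μ μ₀ n z z'

/-- (H2): the homogeneous random walk with step distribution `μ` is irreducible on `ℤ^d`. -/
def H2 (μ : Zd d → ℝ) : Prop := ∀ z z' : Zd d, ∃ n, 0 < homN μ n z z'

/-- (H3) for a single measure: the jump generating function is finite everywhere
(the defining series converges for every `a ∈ ℝ^d`). -/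
def H3 (μ : Zd d → ℝ) : Prop := ∀ a : Rd d, Summable fun z => μ z * Real.exp (dotZ a z)

/-- (H4): the last coordinate of the `μ`-random walk is aperiodic
(the gcd of `{n : p^n(0,0) > 0}` equals `1`). -/
def H4 (μ : Zd d → ℝ) : Prop := ∀ m : ℕ, (∀ n : ℕ, 0 < lastN μ n 0 0 → m ∣ n) → m = 1

/-- The sublevel set `D^t = {a : φ(a) ≤ t}`. -/
def Dset (μ : Zd d → ℝ) (t : ℝ) : Set (Rd d) := {a | phi μ a ≤ t}

/-- `Θ^t = {α ∈ ℝ^{d-1} : inf_β max(φ(α,β), φ₀(α,β)) ≤ t}`. -/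
def Theta (μ μ₀ : Zd d → ℝ) (t : ℝ) : Set (Fin d → ℝ) :=
  {α | sInf (Set.range fun β : ℝ => max (phi μ (α, β)) (phi μ₀ (α, β))) ≤ t}

/-- `Ĥ^t = (Θ^t × ℝ) ∩ D^t`. -/
def Hhat (μ μ₀ : Zd d → ℝ) (t : ℝ) : Set (Rd d) :=
  {a | a.1 ∈ Theta μ μ₀ t ∧ phi μ a ≤ t}

/-- Partial derivative of `f : ℝ^d → ℝ` in the last coordinate. -/
def dBeta (f : Rd d → ℝ) (a : Rd d) : ℝ := fderiv ℝ f a (0, 1)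

/-- The (coordinate) gradient of `f : ℝ^d → ℝ`. -/
def gradV (f : Rd d → ℝ) (a : Rd d) : Rd d :=
  (fun i => fderiv ℝ f a (Pi.single i 1, 0), fderiv ℝ f a (0, 1))

/-- `∂₊D^t`: boundary points of `D^t` where the last coordinate of `∇φ` is `≥ 0`. -/
def dPlus (μ : Zd d → ℝ) (t : ℝ) : Set (Rd d) :=
  {a | a ∈ frontier (Dset μ t) ∧ 0 ≤ dBeta (phi μ) a}

/-- `∂₀D^t`: boundary points of `D^t` where the last coordinate of `∇φ` is `0`. -/
def dZero (μ : Zd d → ℝ) (t : ℝ) : Set (Rd d) :=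
  {a | a ∈ frontier (Dset μ t) ∧ dBeta (phi μ) a = 0}

/-- `Γ₊^t = Ĥ^t ∩ ∂₊D^t`. -/
def GammaPlus (μ μ₀ : Zd d → ℝ) (t : ℝ) : Set (Rd d) := Hhat μ μ₀ t ∩ dPlus μ t

/-- The normal cone `V_t(a)` to `Ĥ^t` at `a`. -/
def Vcone (μ μ₀ : Zd d → ℝ) (t : ℝ) (a : Rd d) : Set (Rd d) :=
  {q | ∀ a' ∈ Hhat μ μ₀ t, dotR q (a' - a) ≤ 0}

/-- `β̄ = min{b : φ(α,b) ≤ t}`. -/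
def betaBar (μ : Zd d → ℝ) (t : ℝ) (α : Fin d → ℝ) : ℝ := sInf {b : ℝ | phi μ (α, b) ≤ t}

/-- `ā^t`: the lowest point of `D^t` with the same first `d-1` coordinates as `a`. -/
def abar (μ : Zd d → ℝ) (t : ℝ) (a : Rd d) : Rd d := (a.1, betaBar μ t a.1)

/-- The Green function `G_t(z,z') = ∑_n t^{-n} p^(n)(z,z')`. -/
def green (μ μ₀ : Zd d → ℝ) (t : ℝ) (z z' : Ed d) : ℝ :=
  ∑' n, (t ^ n)⁻¹ * kerN μ μ₀ n z z'

/-- The `t`-Martin kernel `K_t(z,z') = G_t(z,z')/G_t(z₀,z')` with reference point `z₀`. -/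
def martin (μ μ₀ : Zd d → ℝ) (t : ℝ) (z₀ z z' : Ed d) : ℝ :=
  green μ μ₀ t z z' / green μ μ₀ t z₀ z'

/-- Euclidean norm on `ℝ^d = ℝ^{d-1} × ℝ`. -/
def euclNorm (a : Rd d) : ℝ := Real.sqrt ((∑ i, a.1 i ^ 2) + a.2 ^ 2)

/-- The point of `ℝ^d` corresponding to `z ∈ E`. -/
def vecE (z : Ed d) : Rd d := (fun i => (z.1 i : ℝ), (z.2 : ℝ))

/-- Euclidean distance from a point `v` to a set `S ⊆ ℝ^d`. -/
def distTo (S : Set (Rd d)) (v : Rd d) : ℝ := sInf ((fun q => euclNorm (v - q)) '' S)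

/-- The function `h_{a,t}` of the paper. -/
def hFun (μ μ₀ : Zd d → ℝ) (t : ℝ) (a : Rd d) (z : Ed d) : ℝ :=
  if a ∉ dZero μ t ∧ phi μ₀ (abar μ t a) < t then
    Real.exp (dotE a z)
      - ((t - phi μ₀ a) / (t - phi μ₀ (abar μ t a))) * Real.exp (dotE (abar μ t a) z)
  else if a = abar μ t a ∧ a ∈ dZero μ t ∧ phi μ₀ a < t then
    ((z.2 : ℝ) + dBeta (phi μ₀) a / (t - phi μ₀ a)) * Real.exp (dotE a z)
  else Real.exp (dotE (abar μ t a) z)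


/-- The l1 norm of a lattice point. -/
def nrm (z : Zd d) : ℝ := (∑ i, |(z.1 i : ℝ)|) + |(z.2 : ℝ)|

lemma nrm_nonneg (z : Zd d) : 0 ≤ nrm z := by
  unfold nrm; positivity

lemma abs_dotZ_le (a : Rd d) (z : Zd d) : |dotZ a z| ≤ ‖a‖ * nrm z := by
  unfold dotZ nrm
  have h1 : ∀ i, |a.1 i| ≤ ‖a‖ := fun i =>
    (norm_le_pi_norm a.1 i).trans (norm_fst_le a)
  have h2 : |a.2| ≤ ‖a‖ := norm_snd_le a
  refine (abs_add_le _ _).trans ?_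
  rw [mul_add, Finset.mul_sum]
  refine add_le_add ((Finset.abs_sum_le_sum_abs _ _).trans (Finset.sum_le_sum fun i _ => ?_)) ?_
  · rw [abs_mul]; exact mul_le_mul_of_nonneg_right (h1 i) (abs_nonneg _)
  · rw [abs_mul]; exact mul_le_mul_of_nonneg_right h2 (abs_nonneg _)

lemma dotZ_add (a b : Rd d) (z : Zd d) : dotZ (a + b) z = dotZ a z + dotZ b z := by
  simp only [dotZ, Prod.fst_add, Prod.snd_add, Pi.add_apply, add_mul, Finset.sum_add_distrib]
  ring

lemma dotZ_smul (c : ℝ) (b : Rd d) (z : Zd d) : dotZ (c • b) z = c * dotZ b z := by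
  simp only [dotZ, Prod.smul_fst, Prod.smul_snd, Pi.smul_apply, smul_eq_mul, mul_add,
    Finset.mul_sum, mul_assoc]

lemma dotZ_sub (a b : Rd d) (z : Zd d) : dotZ (a - b) z = dotZ a z - dotZ b z := by
  have := dotZ_add (a - b) b z
  rw [sub_add_cancel] at this; linarith

lemma dotZ_add_right (a : Rd d) (z w : Zd d) : dotZ a (z + w) = dotZ a z + dotZ a w := by
  simp only [dotZ, Prod.fst_add, Prod.snd_add, Pi.add_apply, Int.cast_add, mul_add,
    Finset.sum_add_distrib]
  ring

/-- The sign vector. -/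
def sgnv (c : ℝ) (e : (Fin d → Bool) × Bool) : Rd d :=
  (fun i => if e.1 i then c else -c, if e.2 then c else -c)

lemma exp_nrm_le (c : ℝ) (a : Rd d) (z : Zd d) :
    Real.exp (dotZ a z + c * nrm z) ≤
      ∑ e : (Fin d → Bool) × Bool, Real.exp (dotZ (a + sgnv c e) z) := by
  have key : dotZ a z + c * nrm z =
      dotZ (a + sgnv c (fun i => decide (0 ≤ z.1 i), decide (0 ≤ z.2))) z := by
    rw [dotZ_add]
    congr 1
    unfold nrm dotZ sgnv
    rw [mul_add, Finset.mul_sum]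
    have hz : ∀ k : ℤ, c * |(k : ℝ)| = (if decide (0 ≤ k) then c else -c) * (k : ℝ) := by
      intro k
      by_cases hk : 0 ≤ k
      · have : (0 : ℝ) ≤ k := by exact_mod_cast hk
        simp [hk, abs_of_nonneg this]
      · have : (k : ℝ) ≤ 0 := by exact_mod_cast (not_le.mp hk).le
        simp [hk, abs_of_nonpos this]
    congr 1
    · exact Finset.sum_congr rfl fun i _ => hz _
    · exact hz _
  rw [key]
  exact Finset.single_le_sum (f := fun e => Real.exp (dotZ (a + sgnv c e) z))
    (fun e _ => (Real.exp_pos _).le) (Finset.mem_univ _)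

lemma summable_exp_nrm {μ : Zd d → ℝ} (hp : ∀ z, 0 ≤ μ z) (h3 : H3 μ) (a : Rd d) (c : ℝ) :
    Summable fun z => μ z * Real.exp (dotZ a z + c * nrm z) := by
  have hs : Summable fun z => ∑ e : (Fin d → Bool) × Bool,
      μ z * Real.exp (dotZ (a + sgnv c e) z) :=
    summable_sum fun e _ => h3 _
  refine Summable.of_nonneg_of_le (fun z => mul_nonneg (hp z) (Real.exp_pos _).le) (fun z => ?_) hs
  rw [← Finset.mul_sum]
  exact mul_le_mul_of_nonneg_left (exp_nrm_le c a z) (hp z)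

/-- The linear form `a ↦ a · z`. -/
def Lz (z : Zd d) : Rd d →L[ℝ] ℝ :=
  LinearMap.mkContinuous
    { toFun := fun a => dotZ a z
      map_add' := fun a b => dotZ_add a b z
      map_smul' := fun c b => dotZ_smul c b z } (nrm z)
    (fun a => by
      rw [mul_comm]; exact abs_dotZ_le a z)

lemma Lz_apply (z : Zd d) (a : Rd d) : Lz z a = dotZ a z := rfl

lemma norm_Lz_le (z : Zd d) : ‖Lz z‖ ≤ nrm z :=
  LinearMap.mkContinuous_norm_le _ (nrm_nonneg z) _

lemma hasFDerivAt_phi {μ : Zd d → ℝ} (hp : ∀ z, 0 ≤ μ z) (h3 : H3 μ) (a : Rd d) :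
    HasFDerivAt (phi μ) (∑' z, (μ z * Real.exp (dotZ a z)) • Lz z) a := by
  have hu := summable_exp_nrm hp h3 a 2
  refine hasFDerivAt_tsum_of_isPreconnected (s := Metric.ball a 1) (x₀ := a)
    (f := fun z x => μ z * Real.exp (dotZ x z))
    (f' := fun z x => (μ z * Real.exp (dotZ x z)) • Lz z)
    hu Metric.isOpen_ball (convex_ball a 1).isPreconnected ?_ ?_
    (Metric.mem_ball_self one_pos) (h3 a) (Metric.mem_ball_self one_pos)
  · intro z x _
    have h := ((Lz z).hasFDerivAt (x := x)).exp.const_mul (μ z)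
    simpa [Lz_apply, smul_smul] using h
  · intro z x hx
    rw [norm_smul, Real.norm_of_nonneg (mul_nonneg (hp z) (Real.exp_pos _).le), mul_assoc]
    refine mul_le_mul_of_nonneg_left ?_ (hp z)
    have h1 : dotZ x z ≤ dotZ a z + nrm z := by
      have h := abs_dotZ_le (x - a) z
      rw [dotZ_sub] at h
      have h2 : ‖x - a‖ ≤ 1 := by
        rw [← dist_eq_norm]; exact (Metric.mem_ball.mp hx).le
      have := (le_abs_self _).trans (h.trans (mul_le_of_le_one_left (nrm_nonneg z) h2))
      linarith
    calc Real.exp (dotZ x z) * ‖Lz z‖ ≤ Real.exp (dotZ a z + nrm z) * Real.exp (nrm z) := by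
          refine mul_le_mul (Real.exp_le_exp.mpr h1) ?_ (norm_nonneg _) (Real.exp_pos _).le
          exact (norm_Lz_le z).trans (by linarith [Real.add_one_le_exp (nrm z)])
      _ = _ := by rw [← Real.exp_add]; congr 1; ring

lemma hasSum_fderiv {μ : Zd d → ℝ} (hp : ∀ z, 0 ≤ μ z) (h3 : H3 μ) (a v : Rd d) :
    HasSum (fun z => μ z * Real.exp (dotZ a z) * dotZ v z) (fderiv ℝ (phi μ) a v) := by
  rw [(hasFDerivAt_phi hp h3 a).fderiv]
  have hs : Summable fun z => (μ z * Real.exp (dotZ a z)) • Lz z := by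
    refine Summable.of_norm_bounded (summable_exp_nrm hp h3 a 1) fun z => ?_
    rw [norm_smul, Real.norm_of_nonneg (mul_nonneg (hp z) (Real.exp_pos _).le), mul_assoc,
      Real.exp_add]
    refine mul_le_mul_of_nonneg_left (mul_le_mul_of_nonneg_left ?_ (Real.exp_pos _).le) (hp z)
    exact (norm_Lz_le z).trans (by linarith [Real.add_one_le_exp (1 * nrm z)])
  have := hs.hasSum.mapL (ContinuousLinearMap.apply ℝ ℝ v)
  simpa [Lz_apply] using this

lemma phi_continuous {μ : Zd d → ℝ} (hp : ∀ z, 0 ≤ μ z) (h3 : H3 μ) : Continuous (phi μ) :=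
  continuous_iff_continuousAt.mpr fun a => (hasFDerivAt_phi hp h3 a).continuousAt

lemma tangent_term (m x y : ℝ) (hm : 0 ≤ m) :
    m * Real.exp x + m * Real.exp x * (y - x) ≤ m * Real.exp y := by
  have h : Real.exp y = Real.exp x * Real.exp (y - x) := by rw [← Real.exp_add]; congr 1; ring
  rw [h]
  have := Real.add_one_le_exp (y - x)
  have h2 := mul_le_mul_of_nonneg_left this (mul_nonneg hm (Real.exp_pos x).le)
  linarith

lemma phi_tangent {μ : Zd d → ℝ} (hp : ∀ z, 0 ≤ μ z) (h3 : H3 μ) (a b : Rd d) :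
    phi μ a + fderiv ℝ (phi μ) a (b - a) ≤ phi μ b := by
  refine hasSum_le (fun z => ?_) ((h3 a).hasSum.add (hasSum_fderiv hp h3 a (b - a))) (h3 b).hasSum
  rw [dotZ_sub]
  exact tangent_term _ _ _ (hp z)

lemma phi_tangent_lt {μ : Zd d → ℝ} (hp : ∀ z, 0 ≤ μ z) (h3 : H3 μ) (a b : Rd d)
    (z : Zd d) (hz : 0 < μ z) (hne : dotZ (b - a) z ≠ 0) :
    phi μ a + fderiv ℝ (phi μ) a (b - a) < phi μ b := by
  refine hasSum_lt (i := z) (fun z => ?_) ?_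
    ((h3 a).hasSum.add (hasSum_fderiv hp h3 a (b - a))) (h3 b).hasSum
  · show _ ≤ μ z * Real.exp (dotZ b z)
    rw [dotZ_sub]
    exact tangent_term _ _ _ (hp z)
  · show _ < μ z * Real.exp (dotZ b z)
    have h : Real.exp (dotZ b z) = Real.exp (dotZ a z) * Real.exp (dotZ (b - a) z) := by
      rw [← Real.exp_add, dotZ_sub]; congr 1; ring
    rw [h]
    have := Real.add_one_lt_exp hne
    have h2 := mul_lt_mul_of_pos_left this (mul_pos hz (Real.exp_pos (dotZ a z)))
    linarith

lemma phi_nonneg {μ : Zd d → ℝ} (hp : ∀ z, 0 ≤ μ z) (a : Rd d) : 0 ≤ phi μ a :=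
  tsum_nonneg fun z => mul_nonneg (hp z) (Real.exp_pos _).le

lemma term_le_phi {μ : Zd d → ℝ} (hp : ∀ z, 0 ≤ μ z) (h3 : H3 μ) (a : Rd d) (z : Zd d) :
    μ z * Real.exp (dotZ a z) ≤ phi μ a :=
  (h3 a).le_tsum z fun w _ => mul_nonneg (hp w) (Real.exp_pos _).le

lemma phi_convex {μ : Zd d → ℝ} (hp : ∀ z, 0 ≤ μ z) (h3 : H3 μ) (a b : Rd d) (r : ℝ)
    (h0 : 0 ≤ r) (h1 : r ≤ 1) :
    phi μ ((1 - r) • a + r • b) ≤ (1 - r) * phi μ a + r * phi μ b := by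
  set c := (1 - r) • a + r • b with hc
  have e1 := phi_tangent hp h3 c a
  have e2 := phi_tangent hp h3 c b
  have e3 : (1 - r) * fderiv ℝ (phi μ) c (a - c) + r * fderiv ℝ (phi μ) c (b - c) = 0 := by
    rw [← smul_eq_mul, ← smul_eq_mul, ← map_smul, ← map_smul, ← map_add]
    have : (1 - r) • (a - c) + r • (b - c) = 0 := by
      have : (1 - r) • (a - c) + r • (b - c) = ((1 - r) • a + r • b) - c := by module
      rw [this, hc, sub_self]
    rw [this, map_zero]
  nlinarith [mul_le_mul_of_nonneg_left e1 (sub_nonneg.mpr h1), mul_le_mul_of_nonneg_left e2 h0]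

/-- Local descent along a direction of negative derivative. -/
lemma descent {μ : Zd d → ℝ} (hp : ∀ z, 0 ≤ μ z) (h3 : H3 μ) (a v : Rd d)
    (hv : fderiv ℝ (phi μ) a v < 0) :
    ∀ᶠ s : ℝ in nhdsWithin 0 (Set.Ioi 0), phi μ (a + s • v) < phi μ a := by
  have hd : HasFDerivAt (phi μ) (fderiv ℝ (phi μ) a) (a + (0 : ℝ) • v) := by
    simpa using (hasFDerivAt_phi hp h3 a).differentiableAt.hasFDerivAt
  have hl : HasDerivAt (fun s : ℝ => a + s • v) v 0 := by
    simpa using ((hasDerivAt_id (0 : ℝ)).smul_const v).const_add a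
  have h := hd.comp_hasDerivAt (0 : ℝ) hl
  have h2 := (hasDerivWithinAt_iff_tendsto_slope' (Set.self_notMem_Ioi)).mp
    (h.hasDerivWithinAt (s := Set.Ioi 0))
  filter_upwards [h2.eventually_lt_const hv, self_mem_nhdsWithin] with s hs hs0
  have hs0' : (0 : ℝ) < s := hs0
  simp only [slope_def_field, Function.comp, zero_smul, add_zero, sub_zero] at hs
  rw [div_lt_iff₀ hs0'] at hs
  linarith

/-- One-step kernel with values in `[0,∞]`. -/
def kE (μ μ₀ : Zd d → ℝ) (z z' : Ed d) : ENNReal := ENNReal.ofReal (ker μ μ₀ z z')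

/-- `n`-step kernel with values in `[0,∞]`. -/
def KN (μ μ₀ : Zd d → ℝ) : ℕ → Ed d → Ed d → ENNReal
  | 0 => fun z z' => if z = z' then 1 else 0
  | n + 1 => fun z z' => ∑' w, KN μ μ₀ n z w * kE μ μ₀ w z'

lemma jump_injective (z : Ed d) : Function.Injective (jump z) := by
  intro u v h
  simp only [jump, Prod.mk.injEq] at h
  refine Prod.ext ?_ ?_
  · exact sub_left_injective h.1
  · have := h.2; omega

lemma measure_tsum_le {μ : Zd d → ℝ} (hμ : IsMeasure μ) :
    ∑' z, ENNReal.ofReal (μ z) ≤ 1 := by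
  have hs : Summable μ := by
    by_contra h
    have := hμ.2.1
    rw [tsum_eq_zero_of_not_summable h] at this
    exact lt_irrefl _ this
  rw [← ENNReal.ofReal_tsum_of_nonneg hμ.1 hs]
  exact ENNReal.ofReal_le_one.mpr hμ.2.2

lemma kE_sum_le {μ μ₀ : Zd d → ℝ} (hμ : IsMeasure μ) (hμ₀ : IsMeasure μ₀) (z : Ed d) :
    ∑' z', kE μ μ₀ z z' ≤ 1 := by
  unfold kE ker
  split_ifs
  · exact (ENNReal.tsum_comp_le_tsum_of_injective (jump_injective z)
      (fun w => ENNReal.ofReal (μ₀ w))).trans (measure_tsum_le hμ₀)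
  · exact (ENNReal.tsum_comp_le_tsum_of_injective (jump_injective z)
      (fun w => ENNReal.ofReal (μ w))).trans (measure_tsum_le hμ)

lemma KN_sum_le {μ μ₀ : Zd d → ℝ} (hμ : IsMeasure μ) (hμ₀ : IsMeasure μ₀) (n : ℕ) (z : Ed d) :
    ∑' z', KN μ μ₀ n z z' ≤ 1 := by
  induction n with
  | zero => simp [KN]
  | succ n ih =>
    simp only [KN]
    rw [ENNReal.tsum_comm]
    simp only [ENNReal.tsum_mul_left]
    refine le_trans (ENNReal.tsum_le_tsum fun w => ?_) ih
    exact mul_le_of_le_one_right' (kE_sum_le hμ hμ₀ w)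

lemma KN_le_one {μ μ₀ : Zd d → ℝ} (hμ : IsMeasure μ) (hμ₀ : IsMeasure μ₀) (n : ℕ) (z z' : Ed d) :
    KN μ μ₀ n z z' ≤ 1 := (ENNReal.le_tsum z').trans (KN_sum_le hμ hμ₀ n z)

lemma ker_nonneg {μ μ₀ : Zd d → ℝ} (hμ : IsMeasure μ) (hμ₀ : IsMeasure μ₀) (z z' : Ed d) :
    0 ≤ ker μ μ₀ z z' := by
  unfold ker; split_ifs
  · exact hμ₀.1 _
  · exact hμ.1 _

lemma kerN_eq {μ μ₀ : Zd d → ℝ} (hμ : IsMeasure μ) (hμ₀ : IsMeasure μ₀) (n : ℕ) (z z' : Ed d) :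
    kerN μ μ₀ n z z' = (KN μ μ₀ n z z').toReal := by
  induction n generalizing z' with
  | zero => simp only [KN, kerN]; split_ifs <;> simp
  | succ n ih =>
    simp only [KN, kerN]
    rw [ENNReal.tsum_toReal_eq]
    · refine tsum_congr fun w => ?_
      rw [ih, ENNReal.toReal_mul, kE, ENNReal.toReal_ofReal (ker_nonneg hμ hμ₀ w z')]
    · intro w
      exact ENNReal.mul_ne_top (ne_top_of_le_ne_top ENNReal.one_ne_top (KN_le_one hμ hμ₀ n z w))
        ENNReal.ofReal_ne_top

lemma KN_add (μ μ₀ : Zd d → ℝ) (m n : ℕ) (z z' : Ed d) :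
    KN μ μ₀ (m + n) z z' = ∑' w, KN μ μ₀ m z w * KN μ μ₀ n w z' := by
  induction n generalizing z' with
  | zero =>
    rw [tsum_eq_single z']
    · simp [KN]
    · intro b hb; simp [KN, hb]
  | succ n ih =>
    rw [← add_assoc]
    simp only [KN, ih, ← ENNReal.tsum_mul_left, ← ENNReal.tsum_mul_right, mul_assoc]
    rw [ENNReal.tsum_comm]

lemma KN_one (μ μ₀ : Zd d → ℝ) (z z' : Ed d) : KN μ μ₀ 1 z z' = kE μ μ₀ z z' := by
  simp only [KN]
  rw [tsum_eq_single z]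
  · simp
  · intro b hb; simp [Ne.symm hb]

lemma KN_succ' (μ μ₀ : Zd d → ℝ) (n : ℕ) (z z' : Ed d) :
    KN μ μ₀ (n + 1) z z' = ∑' w, kE μ μ₀ z w * KN μ μ₀ n w z' := by
  rw [add_comm, KN_add]; simp only [KN_one]

/-- Green function towards the origin, `[0,∞]`-valued. -/
def hE (μ μ₀ : Zd d → ℝ) (s : ℝ) (z : Ed d) : ENNReal :=
  ∑' n, (ENNReal.ofReal s)⁻¹ ^ n * KN μ μ₀ n z 0

lemma hE_super {μ μ₀ : Zd d → ℝ} {s : ℝ} (hs : 0 < s) (z : Ed d) :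
    ∑' w, kE μ μ₀ z w * hE μ μ₀ s w ≤ ENNReal.ofReal s * hE μ μ₀ s z := by
  have hs0 : ENNReal.ofReal s ≠ 0 := by simpa using hs
  have h1 : ∑' w, kE μ μ₀ z w * hE μ μ₀ s w =
      ∑' n, (ENNReal.ofReal s)⁻¹ ^ n * KN μ μ₀ (n + 1) z 0 := by
    simp only [hE, KN_succ', ← ENNReal.tsum_mul_left]
    rw [ENNReal.tsum_comm]
    refine tsum_congr fun n => tsum_congr fun w => ?_
    ring
  have h2 : ∀ n, (ENNReal.ofReal s)⁻¹ ^ n * KN μ μ₀ (n + 1) z 0 =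
      ENNReal.ofReal s * ((ENNReal.ofReal s)⁻¹ ^ (n + 1) * KN μ μ₀ (n + 1) z 0) := by
    intro n
    rw [pow_succ, ← mul_assoc, ← mul_assoc, mul_comm (ENNReal.ofReal s), mul_assoc (_ ^ n),
      ENNReal.mul_inv_cancel hs0 ENNReal.ofReal_ne_top, mul_one]
  rw [h1]
  simp only [h2]
  rw [ENNReal.tsum_mul_left]
  refine mul_le_mul_right ?_ _
  exact ENNReal.tsum_comp_le_tsum_of_injective (add_left_injective 1)
    (fun n => (ENNReal.ofReal s)⁻¹ ^ n * KN μ μ₀ n z 0)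

lemma hE_zero_lt_top {μ μ₀ : Zd d → ℝ} (hμ : IsMeasure μ) (hμ₀ : IsMeasure μ₀) {r s : ℝ}
    (hr : rho μ μ₀ < r) (hr0 : 0 < r) (hrs : r < s) : hE μ μ₀ s 0 ≠ ⊤ := by
  have hs : 0 < s := hr0.trans hrs
  have hk0 : ∀ n, 0 ≤ kerN μ μ₀ n 0 0 := fun n => by
    rw [kerN_eq hμ hμ₀]; exact ENNReal.toReal_nonneg
  have hk1 : ∀ n, kerN μ μ₀ n 0 0 ≤ 1 := fun n => by
    rw [kerN_eq hμ hμ₀]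
    exact ENNReal.toReal_le_of_le_ofReal zero_le_one (by simpa using KN_le_one hμ hμ₀ n 0 0)
  have hb : IsBoundedUnder (· ≤ ·) atTop
      (fun n : ℕ => (kerN μ μ₀ n 0 0) ^ ((n : ℝ)⁻¹)) :=
    isBoundedUnder_of ⟨1, fun n => Real.rpow_le_one (hk0 n) (hk1 n) (by positivity)⟩
  have he := eventually_lt_of_limsup_lt hr hb
  have he2 : ∀ᶠ n : ℕ in atTop, ‖s⁻¹ ^ n * kerN μ μ₀ n 0 0‖ ≤ (r / s) ^ n := by
    filter_upwards [he, eventually_ge_atTop 1] with n hn hn1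
    have hn0 : n ≠ 0 := by omega
    have h3 : kerN μ μ₀ n 0 0 ≤ r ^ n := by
      have := pow_le_pow_left₀ (Real.rpow_nonneg (hk0 n) _) hn.le n
      rwa [Real.rpow_inv_natCast_pow (hk0 n) hn0] at this
    rw [Real.norm_of_nonneg (mul_nonneg (by positivity) (hk0 n)), div_pow, div_eq_inv_mul,
      ← inv_pow]
    exact mul_le_mul_of_nonneg_left h3 (by positivity)
  have hsum : Summable fun n => s⁻¹ ^ n * kerN μ μ₀ n 0 0 :=
    Summable.of_norm_bounded_eventually_nat
      (summable_geometric_of_lt_one (by positivity) ((div_lt_one hs).mpr hrs)) he2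
  have : hE μ μ₀ s 0 = ENNReal.ofReal (∑' n, s⁻¹ ^ n * kerN μ μ₀ n 0 0) := by
    rw [ENNReal.ofReal_tsum_of_nonneg (fun n => mul_nonneg (by positivity) (hk0 n)) hsum]
    refine tsum_congr fun n => ?_
    rw [ENNReal.ofReal_mul (by positivity), ENNReal.ofReal_pow (by positivity),
      ENNReal.ofReal_inv_of_pos hs, kerN_eq hμ hμ₀, ENNReal.ofReal_toReal]
    exact ne_top_of_le_ne_top ENNReal.one_ne_top (KN_le_one hμ hμ₀ n 0 0)
  rw [this]; exact ENNReal.ofReal_ne_top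

lemma KN_pos {μ μ₀ : Zd d → ℝ} (hμ : IsMeasure μ) (hμ₀ : IsMeasure μ₀) {n : ℕ} {z z' : Ed d}
    (h : 0 < kerN μ μ₀ n z z') : KN μ μ₀ n z z' ≠ 0 := by
  intro h0
  rw [kerN_eq hμ hμ₀, h0] at h
  simp at h

lemma hE_pos {μ μ₀ : Zd d → ℝ} (hμ : IsMeasure μ) (hμ₀ : IsMeasure μ₀) (h1 : H1 μ μ₀) {s : ℝ}
    (z : Ed d) : hE μ μ₀ s z ≠ 0 := by
  obtain ⟨n, hn⟩ := h1 z 0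
  intro h
  have := ENNReal.tsum_eq_zero.mp h n
  rcases mul_eq_zero.mp this with h | h
  · have h' := eq_zero_of_pow_eq_zero h
    simp at h'
  · exact KN_pos hμ hμ₀ hn h

lemma KN_mul_hE_le {μ μ₀ : Zd d → ℝ} {s : ℝ} (hs : 0 < s) (m : ℕ) (z z' : Ed d) :
    KN μ μ₀ m z z' * hE μ μ₀ s z' ≤ ENNReal.ofReal s ^ m * hE μ μ₀ s z := by
  induction m generalizing z with
  | zero =>
    simp only [KN]
    split_ifs with h
    · simp [h]
    · simp
  | succ m ih =>
    rw [KN_succ', ← ENNReal.tsum_mul_right]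
    calc ∑' w, kE μ μ₀ z w * KN μ μ₀ m w z' * hE μ μ₀ s z'
        ≤ ∑' w, ENNReal.ofReal s ^ m * (kE μ μ₀ z w * hE μ μ₀ s w) := by
          refine ENNReal.tsum_le_tsum fun w => ?_
          rw [mul_assoc, mul_left_comm (_ ^ m)]
          exact mul_le_mul_right (ih w) _
      _ ≤ ENNReal.ofReal s ^ m * (ENNReal.ofReal s * hE μ μ₀ s z) := by
          rw [ENNReal.tsum_mul_left]
          exact mul_le_mul_right (hE_super hs z) _
      _ = _ := by rw [pow_succ, mul_assoc]

lemma hE_ne_top {μ μ₀ : Zd d → ℝ} (hμ : IsMeasure μ) (hμ₀ : IsMeasure μ₀) (h1 : H1 μ μ₀) {s : ℝ}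
    (hs : 0 < s) (h0 : hE μ μ₀ s 0 ≠ ⊤) (z : Ed d) : hE μ μ₀ s z ≠ ⊤ := by
  obtain ⟨n, hn⟩ := h1 0 z
  intro h
  have := KN_mul_hE_le (μ := μ) (μ₀ := μ₀) hs n 0 z
  rw [h, ENNReal.mul_top (KN_pos hμ hμ₀ hn), top_le_iff] at this
  exact ENNReal.mul_ne_top (ENNReal.pow_ne_top ENNReal.ofReal_ne_top) h0 this

/-- Positive superharmonic function on the lattice half space. -/
lemma exists_super {μ μ₀ : Zd d → ℝ} (hμ : IsMeasure μ) (hμ₀ : IsMeasure μ₀)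
    (h0 : H0 μ μ₀) (h1 : H1 μ μ₀) {t : ℝ} (ht0 : 0 < t) (ht : rho μ μ₀ < t) :
    ∃ s : ℝ, 0 < s ∧ s < t ∧ ∃ h : Zd d → ℝ, (∀ z, 0 < h z) ∧
      (∀ z : Zd d, 1 ≤ z.2 → Summable (fun w => μ w * h (z + w)) ∧
        ∑' w, μ w * h (z + w) ≤ s * h z) ∧
      (∀ z w : Zd d, z.2 = 0 → 0 ≤ w.2 → μ₀ w * h (z + w) ≤ s * h z) := by
  obtain ⟨r, hr, hrt⟩ := exists_between (max_lt ht ht0)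
  obtain ⟨s, hrs, hst⟩ := exists_between hrt
  have hr0 : 0 < r := (le_max_right _ _).trans_lt hr
  have hs : 0 < s := hr0.trans hrs
  have htop := hE_ne_top hμ hμ₀ h1 hs
    (hE_zero_lt_top hμ hμ₀ ((le_max_left _ _).trans_lt hr) hr0 hrs)
  refine ⟨s, hs, hst, fun z => (hE μ μ₀ s (z.1, z.2.toNat)).toReal, fun z =>
    ENNReal.toReal_pos (hE_pos hμ hμ₀ h1 _) (htop _), ?_, ?_⟩
  · intro z hz
    set zE : Ed d := (z.1, z.2.toNat) with hzE
    have hsup := hE_super (μ := μ) (μ₀ := μ₀) hs zE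
    have hz2 : zE.2 ≠ 0 := by simp only [hzE]; omega
    have hfin : ENNReal.ofReal s * hE μ μ₀ s zE ≠ ⊤ :=
      ENNReal.mul_ne_top ENNReal.ofReal_ne_top (htop _)
    set F : Zd d → ENNReal := fun w =>
      ENNReal.ofReal (μ w) * hE μ μ₀ s ((z + w).1, (z + w).2.toNat) with hF
    have hsumeq : ∑' w, kE μ μ₀ zE w * hE μ μ₀ s w = ∑' w, F w := by
      rw [← (jump_injective zE).tsum_eq (f := F)]
      · refine tsum_congr fun u => ?_
        simp only [hF, kE, ker, if_neg hz2]
        congr 2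
        refine Prod.ext ?_ ?_
        · simp [jump, hzE]
        · simp only [jump, hzE, Prod.snd_add]; omega
      · intro w hw
        have hmu : μ w ≠ 0 := by
          intro h; apply hw; simp [hF, h]
        have hw2 : -1 ≤ w.2 := by
          by_contra hc; exact hmu (h0.1 w (by omega))
        refine ⟨(z.1 + w.1, (z.2 + w.2).toNat), ?_⟩
        refine Prod.ext ?_ ?_
        · simp [jump, hzE]
        · simp only [jump, hzE]; omega
    rw [hsumeq] at hsup
    have hne : ∑' w, F w ≠ ⊤ := ne_top_of_le_ne_top hfin hsup
    have hto : ∀ w, (F w).toReal = μ w * (hE μ μ₀ s ((z + w).1, (z + w).2.toNat)).toReal := by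
      intro w; simp only [hF]
      rw [ENNReal.toReal_mul, ENNReal.toReal_ofReal (hμ.1 w)]
    constructor
    · have := ENNReal.summable_toReal hne
      simpa only [hto] using this
    · have h4 := ENNReal.toReal_mono hfin hsup
      rw [ENNReal.tsum_toReal_eq (ENNReal.ne_top_of_tsum_ne_top hne), ENNReal.toReal_mul,
        ENNReal.toReal_ofReal hs.le] at h4
      simpa only [hto] using h4
  · intro z w hz hw
    have hsup := (ENNReal.le_tsum ((z + w).1, (z + w).2.toNat)).trans
      (hE_super (μ := μ) (μ₀ := μ₀) hs (z.1, z.2.toNat))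
    have hfin : ENNReal.ofReal s * hE μ μ₀ s (z.1, z.2.toNat) ≠ ⊤ :=
      ENNReal.mul_ne_top ENNReal.ofReal_ne_top (htop _)
    have h4 := ENNReal.toReal_mono hfin hsup
    have hj : jump (z.1, z.2.toNat) ((z + w).1, (z + w).2.toNat) = w := by
      refine Prod.ext ?_ ?_
      · simp [jump]
      · simp only [jump, Prod.snd_add]; omega
    rw [ENNReal.toReal_mul, ENNReal.toReal_mul, ENNReal.toReal_ofReal hs.le, kE,
      ENNReal.toReal_ofReal (ker_nonneg hμ hμ₀ _ _), ker, hj, hz] at h4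
    simpa [hz] using h4

lemma homN_nonneg {μ : Zd d → ℝ} (hp : ∀ z, 0 ≤ μ z) (n : ℕ) (u v : Zd d) :
    0 ≤ homN μ n u v := by
  induction n generalizing v with
  | zero => simp only [homN]; split_ifs <;> simp
  | succ n ih => exact tsum_nonneg fun w => mul_nonneg (ih w) (hp _)

lemma homN_step {μ : Zd d → ℝ} (hp : ∀ z, 0 ≤ μ z) {n : ℕ} {u v : Zd d}
    (h : 0 < homN μ (n + 1) u v) : ∃ w, 0 < homN μ n u w ∧ 0 < μ (v - w) := by
  by_contra hc
  push Not at hc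
  have : homN μ (n + 1) u v = 0 := by
    simp only [homN]
    refine (tsum_congr fun w => ?_).trans tsum_zero
    rcases (homN_nonneg hp n u w).eq_or_lt with h1 | h1
    · rw [← h1, zero_mul]
    · rw [le_antisymm (hc w h1) (hp _), mul_zero]
  exact h.ne' this

lemma exists_up {μ : Zd d → ℝ} (hp : ∀ z, 0 ≤ μ z) (h2 : H2 μ) :
    ∃ w : Zd d, 0 < μ w ∧ 1 ≤ w.2 := by
  by_contra hc
  push Not at hc
  have key : ∀ n (v : Zd d), 0 < homN μ n 0 v → v.2 ≤ 0 := by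
    intro n
    induction n with
    | zero =>
      intro v hv
      simp only [homN] at hv
      split_ifs at hv with h
      · rw [← h]; exact le_refl _
      · exact absurd hv (lt_irrefl _)
    | succ n ih =>
      intro v hv
      obtain ⟨w, hw1, hw2⟩ := homN_step hp hv
      have e1 := ih w hw1
      have e2 := hc _ hw2
      simp only [Prod.snd_sub] at e2
      omega
  obtain ⟨n, hn⟩ := h2 0 (0, 1)
  have := key n _ hn
  simp at this

lemma exists_down {μ : Zd d → ℝ} (hp : ∀ z, 0 ≤ μ z) (h2 : H2 μ) :
    ∃ w : Zd d, 0 < μ w ∧ w.2 ≤ -1 := by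
  by_contra hc
  push Not at hc
  have key : ∀ n (v : Zd d), 0 < homN μ n 0 v → 0 ≤ v.2 := by
    intro n
    induction n with
    | zero =>
      intro v hv
      simp only [homN] at hv
      split_ifs at hv with h
      · rw [← h]; exact le_refl _
      · exact absurd hv (lt_irrefl _)
    | succ n ih =>
      intro v hv
      obtain ⟨w, hw1, hw2⟩ := homN_step hp hv
      have e1 := ih w hw1
      have e2 := hc _ hw2
      simp only [Prod.snd_sub] at e2
      omega
  obtain ⟨n, hn⟩ := h2 0 (0, -1)
  have := key n _ hn
  simp at this

lemma exists_up₀ {μ μ₀ : Zd d → ℝ} (hμ : IsMeasure μ) (hμ₀ : IsMeasure μ₀) (h1 : H1 μ μ₀) :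
    ∃ w : Zd d, 0 < μ₀ w ∧ 1 ≤ w.2 := by
  by_contra hc
  push Not at hc
  have key : ∀ n (v : Ed d), KN μ μ₀ n 0 v ≠ 0 → v.2 = 0 := by
    intro n
    induction n with
    | zero =>
      intro v hv
      simp only [KN] at hv
      split_ifs at hv with h
      · rw [← h]; rfl
      · exact absurd rfl hv
    | succ n ih =>
      intro v hv
      simp only [KN] at hv
      by_contra hv2
      apply hv
      rw [ENNReal.tsum_eq_zero]
      intro w
      by_cases hw : KN μ μ₀ n 0 w = 0
      · rw [hw, zero_mul]
      · have hw2 := ih w hw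
        have : μ₀ (jump w v) ≤ 0 := by
          by_contra hpos
          have := hc _ (not_le.mp hpos)
          simp only [jump, hw2] at this
          omega
        simp [kE, ker, hw2, this]
  obtain ⟨n, hn⟩ := h1 0 (0, 1)
  have := key n _ (KN_pos hμ hμ₀ hn)
  simp at this

lemma log_step {m x y s : ℝ} (hm : 0 < m) (hx : 0 < x) (hs : 0 < s) (hy : 0 < y)
    (h : m * x ≤ s * y) : Real.log x - |Real.log s - Real.log m| ≤ Real.log y := by
  have := Real.log_le_log (mul_pos hm hx) h
  rw [Real.log_mul hm.ne' hx.ne', Real.log_mul hs.ne' hy.ne'] at this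
  have h2 := le_abs_self (Real.log s - Real.log m)
  linarith

/-- Harnack estimate for words of positive probability. -/
lemma harnack_word {μ : Zd d → ℝ} (hp : ∀ z, 0 ≤ μ z) (hd : ∀ z : Zd d, z.2 < -1 → μ z = 0)
    {s : ℝ} (hs : 0 < s) {h : Zd d → ℝ} (hpos : ∀ z, 0 < h z)
    (hst : ∀ z w : Zd d, 1 ≤ z.2 → μ w * h (z + w) ≤ s * h z) (n : ℕ) (v : Zd d)
    (hv : 0 < homN μ n 0 v) :
    -(n : ℤ) ≤ v.2 ∧ ∃ c : ℝ, 0 ≤ c ∧ ∀ z : Zd d, (n : ℤ) + 1 ≤ z.2 →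
      Real.log (h (z + v)) - c ≤ Real.log (h z) := by
  induction n generalizing v with
  | zero =>
    simp only [homN] at hv
    split_ifs at hv with h
    · subst h
      exact ⟨by simp, 0, le_refl _, fun z _ => by simp⟩
    · exact absurd hv (lt_irrefl _)
  | succ n ih =>
    obtain ⟨w, hw1, hw2⟩ := homN_step hp hv
    obtain ⟨e1, c, hc, e2⟩ := ih w hw1
    have hdw : -1 ≤ (v - w).2 := by
      by_contra hcon
      exact hw2.ne' (hd _ (by omega))
    simp only [Prod.snd_sub] at hdw
    refine ⟨by push_cast; omega, c + |Real.log s - Real.log (μ (v - w))|, by positivity, ?_⟩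
    intro z hz
    push_cast at hz
    have f1 := e2 z (by omega)
    have f2 := hst (z + w) (v - w) (by simp only [Prod.snd_add]; omega)
    rw [show z + w + (v - w) = z + v by abel] at f2
    have f3 := log_step hw2 (hpos _) hs (hpos _) f2
    linarith

/-- integer l1 norm -/
def nz (z : Zd d) : ℕ := (∑ i, (z.1 i).natAbs) + z.2.natAbs

lemma nrm_eq_nz (z : Zd d) : nrm z = (nz z : ℝ) := by
  simp [nrm, nz, Nat.cast_natAbs]

lemma nrm_add_le (z w : Zd d) : nrm (z + w) ≤ nrm z + nrm w := by
  simp only [nrm, Prod.fst_add, Prod.snd_add, Pi.add_apply, Int.cast_add]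
  have h1 : ∑ i, |(z.1 i : ℝ) + (w.1 i : ℝ)| ≤ ∑ i, |(z.1 i : ℝ)| + ∑ i, |(w.1 i : ℝ)| := by
    rw [← Finset.sum_add_distrib]
    exact Finset.sum_le_sum fun i _ => abs_add_le _ _
  have h2 := abs_add_le (z.2 : ℝ) (w.2 : ℝ)
  linarith

/-- unit vectors -/
def unitv (e : Option (Fin d) × Bool) : Zd d :=
  match e with
  | (none, b) => (0, if b then 1 else -1)
  | (some i, b) => (Pi.single i (if b then 1 else -1), 0)

lemma exists_unit (v : Zd d) (hv : v ≠ 0) : ∃ e : Option (Fin d) × Bool,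
    nz (v - unitv e) + 1 = nz v ∧ ((unitv (d := d) e).2 = 0 ∨ ((unitv (d := d) e).2 = 1 ∧ 0 < v.2) ∨
      ((unitv (d := d) e).2 = -1 ∧ v.2 < 0)) := by
  by_cases h2 : v.2 = 0
  · have : ∃ i, v.1 i ≠ 0 := by
      by_contra hc
      push Not at hc
      exact hv (Prod.ext (funext hc) h2)
    obtain ⟨i, hi⟩ := this
    refine ⟨(some i, decide (0 < v.1 i)), ?_, Or.inl rfl⟩
    simp only [nz, unitv, Prod.fst_sub, Prod.snd_sub, Pi.sub_apply, sub_zero]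
    rw [← Finset.add_sum_erase _ _ (Finset.mem_univ i), ← Finset.add_sum_erase _ _ (Finset.mem_univ i)]
    have : ∑ x ∈ Finset.univ.erase i, (v.1 x - (Pi.single i (if decide (0 < v.1 i) then 1 else -1) : Fin d → ℤ) x).natAbs =
        ∑ x ∈ Finset.univ.erase i, (v.1 x).natAbs := by
      refine Finset.sum_congr rfl fun x hx => ?_
      rw [Pi.single_eq_of_ne (Finset.ne_of_mem_erase hx), sub_zero]
    rw [this, Pi.single_eq_same]
    by_cases hpos : 0 < v.1 i
    · simp only [hpos, decide_true, if_true]; omega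
    · simp only [hpos, decide_false]; simp; omega
  · refine ⟨(none, decide (0 < v.2)), ?_, ?_⟩
    · simp only [nz, unitv, Prod.fst_sub, Prod.snd_sub, sub_zero]
      by_cases hpos : 0 < v.2
      · simp only [hpos, decide_true, if_true]; omega
      · simp only [hpos, decide_false]; simp; omega
    · by_cases hpos : 0 < v.2
      · simp [unitv, hpos]
      · simp [unitv, hpos]; omega

lemma harnack_high {g : Zd d → ℝ} {R : ℤ} {C : ℝ}
    (hu : ∀ e, ∀ z : Zd d, R ≤ z.2 → g (z + unitv e) - C ≤ g z) (n : ℕ) :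
    ∀ z z' : Zd d, nz (z' - z) = n → R ≤ z.2 → R ≤ z'.2 → g z' - C * n ≤ g z := by
  induction n with
  | zero =>
    intro z z' hn _ _
    have : z' = z := by
      by_contra hne
      obtain ⟨e, he, _⟩ := exists_unit (z' - z) (sub_ne_zero.mpr hne)
      omega
    simp [this]
  | succ n ih =>
    intro z z' hn hz hz'
    have hne : z' - z ≠ 0 := by
      intro h; rw [h] at hn; simp [nz] at hn
    obtain ⟨e, he, he2⟩ := exists_unit (z' - z) hne
    have h1 := hu e z hz
    have h2 := ih (z + unitv e) z' (by rw [← sub_sub]; omega)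
      (by simp only [Prod.snd_add]; simp only [Prod.snd_sub] at he2; omega) hz'
    push_cast
    linarith

lemma harnack {μ μ₀ : Zd d → ℝ} (hμ : IsMeasure μ) (hμ₀ : IsMeasure μ₀)
    (h0 : H0 μ μ₀) (h1 : H1 μ μ₀) (h2 : H2 μ)
    {s : ℝ} (hs : 0 < s) {h : Zd d → ℝ} (hpos : ∀ z, 0 < h z)
    (hst : ∀ z w : Zd d, 1 ≤ z.2 → μ w * h (z + w) ≤ s * h z)
    (hst₀ : ∀ z w : Zd d, z.2 = 0 → 0 ≤ w.2 → μ₀ w * h (z + w) ≤ s * h z) :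
    ∃ (R : ℤ) (C : ℝ), 0 ≤ C ∧ ∀ z z' : Zd d, 0 ≤ z.2 → R ≤ z'.2 →
      Real.log (h z') - C * (1 + nrm (z' - z)) ≤ Real.log (h z) := by
  have hw : ∀ e : Option (Fin d) × Bool, ∃ n : ℕ, ∃ c : ℝ, 0 ≤ c ∧ ∀ z : Zd d, (n : ℤ) + 1 ≤ z.2 →
      Real.log (h (z + unitv e)) - c ≤ Real.log (h z) := by
    intro e
    obtain ⟨n, hn⟩ := h2 0 (unitv e)
    exact ⟨n, (harnack_word hμ.1 h0.1 hs hpos hst n _ hn).2⟩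
  choose n c hc hnc using hw
  set R : ℕ := (∑ e, n e) + 1 with hR
  set C := ∑ e, c e with hC
  have hC0 : 0 ≤ C := Finset.sum_nonneg fun e _ => hc e
  have hu : ∀ e, ∀ z : Zd d, (R : ℤ) ≤ z.2 →
      Real.log (h (z + unitv e)) - C ≤ Real.log (h z) := by
    intro e z hz
    have e1 : n e ≤ ∑ e, n e := Finset.single_le_sum (fun _ _ => Nat.zero_le _) (Finset.mem_univ e)
    have e2 : c e ≤ C := Finset.single_le_sum (fun e _ => hc e) (Finset.mem_univ e)
    have := hnc e z (by omega)
    linarith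
  obtain ⟨u, hu1, hu2⟩ := exists_up hμ.1 h2
  obtain ⟨u₀, hu3, hu4⟩ := exists_up₀ hμ hμ₀ h1
  set c₁ := |Real.log s - Real.log (μ u)| with hc₁
  set c₀ := |Real.log s - Real.log (μ₀ u₀)| with hc₀
  have hrise : ∀ k : ℕ, ∀ z : Zd d, 1 ≤ z.2 → ∃ z' : Zd d, (k : ℤ) + 1 ≤ z'.2 ∧
      nrm (z' - z) ≤ k * nrm u ∧ Real.log (h z') - k * c₁ ≤ Real.log (h z) := by
    intro k
    induction k with
    | zero => intro z hz; exact ⟨z, by simpa using hz, by simp [nrm], by simp⟩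
    | succ k ih =>
      intro z hz
      obtain ⟨z', a1, a2, a3⟩ := ih z hz
      refine ⟨z' + u, by simp only [Prod.snd_add]; push_cast; omega, ?_, ?_⟩
      · rw [show z' + u - z = (z' - z) + u by abel]
        have := nrm_add_le (z' - z) u
        push_cast; linarith
      · have := log_step hu1 (hpos _) hs (hpos _) (hst z' u (by omega))
        push_cast; linarith
  have hrise0 : ∀ z : Zd d, 0 ≤ z.2 → ∃ z' : Zd d, (R : ℤ) ≤ z'.2 ∧
      nrm (z' - z) ≤ R * nrm u + nrm u₀ ∧ Real.log (h z') - (R * c₁ + c₀) ≤ Real.log (h z) := by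
    intro z hz
    by_cases hz1 : 1 ≤ z.2
    · obtain ⟨z', a1, a2, a3⟩ := hrise R z hz1
      refine ⟨z', by omega, ?_, ?_⟩
      · linarith [nrm_nonneg u₀]
      · linarith [abs_nonneg (Real.log s - Real.log (μ₀ u₀))]
    · have hz0 : z.2 = 0 := by omega
      obtain ⟨z', a1, a2, a3⟩ := hrise R (z + u₀) (by simp only [Prod.snd_add]; omega)
      refine ⟨z', by omega, ?_, ?_⟩
      · have := nrm_add_le (z' - (z + u₀)) u₀
        rw [show z' - (z + u₀) + u₀ = z' - z by abel] at this
        linarith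
      · have := log_step hu3 (hpos _) hs (hpos _) (hst₀ z u₀ hz0 (by omega))
        linarith
  set B := (R : ℝ) * nrm u + nrm u₀ with hB
  have hB0 : 0 ≤ B := by have := nrm_nonneg u; have := nrm_nonneg u₀; positivity
  have hD0 : 0 ≤ (R : ℝ) * c₁ + c₀ := by positivity
  refine ⟨R, C * (B + 1) + (R * c₁ + c₀), by positivity, ?_⟩
  intro z z' hz hz'
  obtain ⟨y, a1, a2, a3⟩ := hrise0 z hz
  have b1 := harnack_high (g := fun z => Real.log (h z)) hu _ y z' rfl a1 hz'
  rw [← nrm_eq_nz] at b1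
  have b2 := nrm_add_le (z' - z) (-(y - z))
  rw [show z' - z + -(y - z) = z' - y by abel] at b2
  have b3 : nrm (-(y - z)) = nrm (y - z) := by simp [nrm, abs_sub_comm]
  rw [b3] at b2
  have b4 := nrm_nonneg (z' - z)
  have b5 : C * nrm (z' - y) ≤ C * (nrm (z' - z) + B) :=
    mul_le_mul_of_nonneg_left (by linarith) hC0
  have b6 : 0 ≤ (C * B + (R * c₁ + c₀)) * nrm (z' - z) := by positivity
  nlinarith

/-- Squared Euclidean norm of a lattice point. -/
def Qz (z : Zd d) : ℝ := (∑ i, (z.1 i : ℝ) ^ 2) + (z.2 : ℝ) ^ 2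

lemma Qz_nonneg (z : Zd d) : 0 ≤ Qz z := by unfold Qz; positivity

lemma abs_fst_le_nrm (z : Zd d) (i : Fin d) : |(z.1 i : ℝ)| ≤ nrm z := by
  have := Finset.single_le_sum (f := fun i => |(z.1 i : ℝ)|) (fun i _ => abs_nonneg _)
    (Finset.mem_univ i)
  unfold nrm
  have h2 := abs_nonneg (z.2 : ℝ)
  linarith

lemma abs_snd_le_nrm (z : Zd d) : |(z.2 : ℝ)| ≤ nrm z := by
  unfold nrm
  have : 0 ≤ ∑ i, |(z.1 i : ℝ)| := Finset.sum_nonneg fun i _ => abs_nonneg _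
  linarith

lemma Qz_le (z : Zd d) : Qz z ≤ nrm z ^ 2 := by
  have h1 : ∑ i, (z.1 i : ℝ) ^ 2 ≤ ∑ i, |(z.1 i : ℝ)| * nrm z := by
    refine Finset.sum_le_sum fun i _ => ?_
    rw [← sq_abs, sq]
    exact mul_le_mul_of_nonneg_left (abs_fst_le_nrm z i) (abs_nonneg _)
  have h2 : (z.2 : ℝ) ^ 2 ≤ |(z.2 : ℝ)| * nrm z := by
    rw [← sq_abs, sq]
    exact mul_le_mul_of_nonneg_left (abs_snd_le_nrm z) (abs_nonneg _)
  have h3 : nrm z ^ 2 = (∑ i, |(z.1 i : ℝ)|) * nrm z + |(z.2 : ℝ)| * nrm z := by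
    rw [← add_mul, sq]; rfl
  rw [h3, Finset.sum_mul]
  exact add_le_add h1 h2

lemma Qz_lower {η : ℝ} (hη : 0 < η) (c : ℝ) (z : Zd d) :
    c * nrm z - (d + 1) * (c ^ 2 / (4 * η)) ≤ η * Qz z := by
  have key : ∀ x : ℝ, c * |x| - c ^ 2 / (4 * η) ≤ η * x ^ 2 := by
    intro x
    rw [← sq_abs x]
    have h : η * |x| ^ 2 - (c * |x| - c ^ 2 / (4 * η)) = η * (|x| - c / (2 * η)) ^ 2 := by
      field_simp; ring
    have : 0 ≤ η * (|x| - c / (2 * η)) ^ 2 := by positivity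
    linarith
  unfold nrm Qz
  have h1 := Finset.sum_le_sum (s := Finset.univ) fun (i : Fin d) _ => key (z.1 i)
  rw [Finset.sum_sub_distrib, ← Finset.mul_sum, ← Finset.mul_sum] at h1
  simp only [Finset.sum_const, Finset.card_univ, Fintype.card_fin, nsmul_eq_mul] at h1
  have h2 := key z.2
  linarith

/-- real vector of a lattice point -/
def vecZ (z : Zd d) : Rd d := (fun i => (z.1 i : ℝ), (z.2 : ℝ))

lemma Qz_add (v w : Zd d) : Qz (v + w) = Qz v + Qz w + 2 * dotZ (vecZ v) w := by
  simp only [Qz, dotZ, vecZ, Prod.fst_add, Prod.snd_add, Pi.add_apply, Int.cast_add, add_sq,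
    Finset.sum_add_distrib, mul_add, Finset.mul_sum, mul_assoc]
  ring

lemma summable_Q {μ : Zd d → ℝ} (hp : ∀ z, 0 ≤ μ z) (h3 : H3 μ) (a : Rd d) :
    Summable fun z => μ z * Real.exp (dotZ a z) * Qz z := by
  refine Summable.of_nonneg_of_le
    (fun z => mul_nonneg (mul_nonneg (hp z) (Real.exp_pos _).le) (Qz_nonneg z)) (fun z => ?_)
    ((summable_exp_nrm hp h3 a 1).mul_left 2)
  have h1 := Qz_le z
  have h2 := Real.quadratic_le_exp_of_nonneg (nrm_nonneg z)
  have h3 : Qz z ≤ 2 * Real.exp (nrm z) := by linarith [nrm_nonneg z]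
  rw [one_mul, Real.exp_add]
  have h4 := mul_le_mul_of_nonneg_left h3 (mul_nonneg (hp z) (Real.exp_pos (dotZ a z)).le)
  linarith

lemma nrm_neg (z : Zd d) : nrm (-z) = nrm z := by simp [nrm]

lemma finite_nrm_le (z₀ : Zd d) (M : ℝ) : {z : Zd d | nrm (z - z₀) ≤ M}.Finite := by
  set m : ℤ := ⌈M⌉ with hm
  refine (Set.finite_Icc (z₀ - ((fun _ => m, m) : Zd d)) (z₀ + ((fun _ => m, m) : Zd d))).subset ?_
  intro z hz
  have hz' : nrm (z - z₀) ≤ M := hz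
  have key : ∀ k : ℤ, |(k : ℝ)| ≤ nrm (z - z₀) → |k| ≤ m := by
    intro k hk
    have : ((|k| : ℤ) : ℝ) ≤ (m : ℝ) := by
      push_cast; exact (hk.trans hz').trans (Int.le_ceil M)
    exact_mod_cast this
  have k1 := fun i => abs_le.mp (key _ (abs_fst_le_nrm (z - z₀) i))
  have k2 := abs_le.mp (key _ (abs_snd_le_nrm (z - z₀)))
  simp only [Prod.fst_sub, Prod.snd_sub, Pi.sub_apply] at k1 k2
  refine ⟨⟨fun i => ?_, ?_⟩, ⟨fun i => ?_, ?_⟩⟩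
  · have := (k1 i).1; simp only [Prod.fst_sub, Pi.sub_apply]; omega
  · simp only [Prod.snd_sub]; omega
  · have := (k1 i).2; simp only [Prod.fst_add, Pi.add_apply]; omega
  · simp only [Prod.snd_add]; omega

/-- Above the convergence norm, boundary points of `D^t` are not critical. -/
lemma fderiv_ne_zero {μ μ₀ : Zd d → ℝ} (hμ : IsMeasure μ) (hμ₀ : IsMeasure μ₀)
    (h0 : H0 μ μ₀) (h1 : H1 μ μ₀) (h2 : H2 μ) (h3 : H3 μ) {t : ℝ} (ht : rho μ μ₀ < t)
    (a : Rd d) (hat : phi μ a = t) : fderiv ℝ (phi μ) a ≠ 0 := by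
  intro hgrad
  have ht0 : 0 < t := by
    obtain ⟨w, hw, _⟩ := exists_up hμ.1 h2
    rw [← hat]
    exact (mul_pos hw (Real.exp_pos _)).trans_le (term_le_phi hμ.1 h3 a w)
  obtain ⟨s, hs, hst, h, hpos, hsup, hsup₀⟩ := exists_super hμ hμ₀ h0 h1 ht0 ht
  have hstep : ∀ z w : Zd d, 1 ≤ z.2 → μ w * h (z + w) ≤ s * h z := fun z w hz =>
    ((hsup z hz).1.le_tsum w fun u _ => mul_nonneg (hμ.1 u) (hpos _).le).trans (hsup z hz).2
  obtain ⟨R, C, hC, hH⟩ := harnack hμ hμ₀ h0 h1 h2 hs hpos hstep hsup₀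
  have hQ := summable_Q hμ.1 h3 a
  set σ := ∑' z, μ z * Real.exp (dotZ a z) * Qz z with hσ
  have hσ0 : 0 ≤ σ := tsum_nonneg fun z =>
    mul_nonneg (mul_nonneg (hμ.1 z) (Real.exp_pos _).le) (Qz_nonneg z)
  set η := (t - s) / (σ + 1) with hηdef
  have hη : 0 < η := div_pos (by linarith) (by linarith)
  have hησ : η * σ < t - s := by
    have : η * (σ + 1) = t - s := by rw [hηdef]; field_simp
    linarith
  set c := C + ‖a‖ + 1 with hc
  set M := (d + 1) * (c ^ 2 / (4 * η)) + C with hM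
  set L : ℤ := max (max R 1) (⌈M⌉ + 1) with hL
  set z₀ : Zd d := (0, L) with hz₀
  have hLR : R ≤ z₀.2 := (le_max_left _ _).trans (le_max_left _ _)
  have hL1 : 1 ≤ L := (le_max_right R 1).trans (le_max_left _ _)
  have hLM : ⌈M⌉ + 1 ≤ L := le_max_right _ _
  set F : Zd d → ℝ := fun z => Real.log (h z) - dotZ a z + η * Qz (z - z₀) with hF
  have hFz₀ : F z₀ = Real.log (h z₀) - dotZ a z₀ := by simp [hF, Qz]
  have hlow : ∀ z : Zd d, 0 ≤ z.2 → F z₀ + nrm (z - z₀) - M ≤ F z := by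
    intro z hz
    have e1 := hH z z₀ hz hLR
    rw [← nrm_neg, neg_sub] at e1
    have e2 := Qz_lower hη c (z - z₀)
    have e3 := (le_abs_self _).trans (abs_dotZ_le a (z - z₀))
    have e4 : dotZ a z = dotZ a (z - z₀) + dotZ a z₀ := by
      rw [← dotZ_add_right, sub_add_cancel]
    rw [hFz₀]
    simp only [hF]
    rw [e4]
    have e5 : c * nrm (z - z₀) = C * nrm (z - z₀) + ‖a‖ * nrm (z - z₀) + nrm (z - z₀) := by
      rw [hc]; ring
    linarith
  set S : Set (Zd d) := {z | 0 ≤ z.2 ∧ F z ≤ F z₀} with hS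
  have hSsub : S ⊆ {z : Zd d | nrm (z - z₀) ≤ M} := by
    intro z hz
    have := hlow z hz.1
    have h5 := hz.2
    show nrm (z - z₀) ≤ M
    linarith
  have hSfin : S.Finite := (finite_nrm_le z₀ M).subset hSsub
  have hSne : S.Nonempty := ⟨z₀, by show (0 : ℤ) ≤ L; omega, le_refl _⟩
  obtain ⟨y, hyS, hymin⟩ := Set.exists_min_image S F hSfin hSne
  have hmin : ∀ z : Zd d, 0 ≤ z.2 → F y ≤ F z := by
    intro z hz
    by_cases hzS : F z ≤ F z₀
    · exact hymin z ⟨hz, hzS⟩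
    · exact hyS.2.trans (not_le.mp hzS).le
  have hy1 : 1 ≤ y.2 := by
    have e1 : nrm (y - z₀) ≤ M := hSsub hyS
    have e2 := (abs_snd_le_nrm (y - z₀)).trans (e1.trans (Int.le_ceil M))
    have e3 : |(y - z₀).2| ≤ ⌈M⌉ := by exact_mod_cast e2
    have e4 := (abs_le.mp e3).1
    simp only [Prod.snd_sub, hz₀] at e4
    omega
  obtain ⟨hsm, hle⟩ := hsup y hy1
  set v := vecZ (y - z₀) with hv
  have hsum := (((h3 a).hasSum.sub (hQ.hasSum.mul_left η)).sub
    ((hasSum_fderiv hμ.1 h3 a v).mul_left (2 * η))).mul_left (h y)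
  have hcmp := hasSum_le (fun w => ?_) hsum hsm.hasSum
  · have e0 : ∑' z, μ z * Real.exp (dotZ a z) = t := hat
    rw [hgrad, e0] at hcmp
    simp only [zero_apply, mul_zero, sub_zero] at hcmp
    have e1 := hcmp.trans hle
    rw [mul_comm s] at e1
    have := le_of_mul_le_mul_left e1 (hpos y)
    linarith
  · by_cases hw : μ w = 0
    · simp [hw]
    have hw2 : -1 ≤ w.2 := by
      by_contra hcon; exact hw (h0.1 w (by omega))
    have e1 := hmin (y + w) (by simp only [Prod.snd_add]; omega)
    simp only [hF] at e1
    rw [show y + w - z₀ = (y - z₀) + w by abel, Qz_add, dotZ_add_right] at e1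
    have e2 : Real.log (h y) + dotZ a w - η * (Qz w + 2 * dotZ v w) ≤ Real.log (h (y + w)) := by
      linarith
    have e3 := Real.exp_le_exp.mpr e2
    rw [Real.exp_log (hpos _), sub_eq_add_neg, Real.exp_add, Real.exp_add,
      Real.exp_log (hpos _)] at e3
    have e4 := Real.add_one_le_exp (-(η * (Qz w + 2 * dotZ v w)))
    have e5 := mul_le_mul_of_nonneg_left e4
      (mul_nonneg (hpos y).le (Real.exp_pos (dotZ a w)).le)
    have e6 := mul_le_mul_of_nonneg_left (e5.trans e3) (hμ.1 w)
    refine le_trans (le_of_eq ?_) e6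
    ring

lemma dotR_gradV (f : Rd d → ℝ) (a v : Rd d) : dotR (gradV f a) v = fderiv ℝ f a v := by
  have hv : v = ∑ i, v.1 i • ((Pi.single i 1, 0) : Rd d) + v.2 • ((0, 1) : Rd d) := by
    refine Prod.ext ?_ ?_
    · funext j
      simp [Prod.fst_sum, Finset.sum_apply, Pi.single_apply]
    · simp [Prod.snd_sum]
  conv_rhs => rw [hv]
  rw [map_add, map_sum, map_smul]
  simp only [map_smul, smul_eq_mul, dotR, gradV]
  congr 1
  · exact Finset.sum_congr rfl fun i _ => mul_comm _ _
  · exact mul_comm _ _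

lemma dotR_add (q u v : Rd d) : dotR q (u + v) = dotR q u + dotR q v := by
  simp only [dotR, Prod.fst_add, Prod.snd_add, Pi.add_apply, mul_add, Finset.sum_add_distrib]
  ring

lemma dotR_smul (q v : Rd d) (c : ℝ) : dotR q (c • v) = c * dotR q v := by
  simp only [dotR, Prod.smul_fst, Prod.smul_snd, Pi.smul_apply, smul_eq_mul, mul_add,
    Finset.mul_sum]
  congr 1
  · exact Finset.sum_congr rfl fun i _ => by ring
  · ring

lemma dotR_smul_left (q v : Rd d) (c : ℝ) : dotR (c • q) v = c * dotR q v := by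
  simp only [dotR, Prod.smul_fst, Prod.smul_snd, Pi.smul_apply, smul_eq_mul, mul_add,
    Finset.mul_sum, mul_assoc]

lemma dotR_ext (p q : Rd d) (h : ∀ v, dotR p v = dotR q v) : p = q := by
  refine Prod.ext (funext fun i => ?_) ?_
  · simpa [dotR, Pi.single_apply] using h (Pi.single i 1, 0)
  · simpa [dotR] using h (0, 1)

/-- Elementary Farkas lemma for one nonzero linear form. -/
lemma farkas (f : Rd d → ℝ) (a q : Rd d) (hne : fderiv ℝ f a ≠ 0)
    (h : ∀ v, fderiv ℝ f a v < 0 → dotR q v ≤ 0) :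
    ∃ c : ℝ, 0 ≤ c ∧ q = c • gradV f a := by
  set l := fderiv ℝ f a with hl
  obtain ⟨u, hu⟩ : ∃ u, l u ≠ 0 := by
    by_contra hc
    push Not at hc
    exact hne (ContinuousLinearMap.ext hc)
  set v₀ := (-(l u)⁻¹) • u with hv₀
  have hlv : l v₀ = -1 := by
    rw [hv₀, map_smul, smul_eq_mul]; field_simp
  clear_value v₀
  have hker : ∀ w, l w = 0 → dotR q w = 0 := by
    intro w hw
    have h1 : ∀ k : ℝ, dotR q v₀ + k * dotR q w ≤ 0 := by
      intro k
      have := h (v₀ + k • w) (by rw [map_add, map_smul, hw, hlv]; simp)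
      rwa [dotR_add, dotR_smul] at this
    by_contra hne0
    have := h1 ((1 - dotR q v₀) / dotR q w)
    rw [div_mul_cancel₀ _ hne0] at this
    linarith
  refine ⟨-dotR q v₀, by linarith [h v₀ (by rw [hlv]; norm_num)], dotR_ext _ _ fun v => ?_⟩
  rw [dotR_smul_left, dotR_gradV]
  have := hker (v + l v • v₀) (by rw [map_add, map_smul, hlv]; simp)
  rw [dotR_add, dotR_smul] at this
  rw [← hl]
  linarith

lemma mem_Theta {μ μ₀ : Zd d → ℝ} (hp : ∀ z, 0 ≤ μ z) {t : ℝ} {α : Fin d → ℝ} (b : ℝ)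
    (h1 : phi μ (α, b) ≤ t) (h2 : phi μ₀ (α, b) ≤ t) : α ∈ Theta μ μ₀ t := by
  have hb : BddBelow (Set.range fun β : ℝ => max (phi μ (α, β)) (phi μ₀ (α, β))) := by
    refine ⟨0, ?_⟩
    rintro _ ⟨x, rfl⟩
    exact (phi_nonneg hp _).trans (le_max_left _ _)
  exact (csInf_le hb (Set.mem_range_self b)).trans (max_le h1 h2)

lemma betaBar_spec {μ : Zd d → ℝ} (hp : ∀ z, 0 ≤ μ z) (h2 : H2 μ) (h3 : H3 μ) {t : ℝ}
    {a : Rd d} (ha : phi μ a ≤ t) :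
    betaBar μ t a.1 ≤ a.2 ∧ phi μ (abar μ t a) ≤ t := by
  obtain ⟨w, hw, hw2⟩ := exists_down hp h2
  set S := {b : ℝ | phi μ (a.1, b) ≤ t} with hS
  have hne : S.Nonempty := ⟨a.2, ha⟩
  have hcl : IsClosed S := by
    refine isClosed_le ((phi_continuous hp h3).comp (by fun_prop)) continuous_const
  have hbd : BddBelow S := by
    set k : ℝ := ∑ i, a.1 i * (w.1 i : ℝ) with hk
    refine ⟨min 0 (k + 1 - t / μ w), ?_⟩
    intro b hb
    rcases le_total 0 b with h | h
    · exact (min_le_left _ _).trans h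
    refine (min_le_right _ _).trans ?_
    have e1 := (term_le_phi hp h3 (a.1, b) w).trans hb
    have e2 : dotZ (a.1, b) w = k + b * (w.2 : ℝ) := rfl
    have e3 := Real.add_one_le_exp (dotZ (a.1, b) w)
    have e4 : Real.exp (dotZ (a.1, b) w) ≤ t / μ w := by
      rw [le_div_iff₀ hw]; linarith
    have e5 : (w.2 : ℝ) ≤ -1 := by exact_mod_cast hw2
    have e6 : -b ≤ b * (w.2 : ℝ) := by nlinarith
    linarith
  exact ⟨csInf_le hbd ha, hcl.csInf_mem hne hbd⟩

/-- On a vertical line through a point with zero vertical derivative, `φ` is strictly larger. -/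
lemma vert_strict {μ : Zd d → ℝ} (hp : ∀ z, 0 ≤ μ z) (h2 : H2 μ) (h3 : H3 μ)
    {a : Rd d} (hd : dBeta (phi μ) a = 0) {b : ℝ} (hb : b ≠ a.2) :
    phi μ a < phi μ (a.1, b) := by
  obtain ⟨w, hw, hw2⟩ := exists_up hp h2
  have e : ((a.1, b) : Rd d) - a = (b - a.2) • ((0, 1) : Rd d) := by
    refine Prod.ext ?_ ?_ <;> simp
  have h := phi_tangent_lt hp h3 a (a.1, b) w hw (by
    rw [e, dotZ_smul]
    have : (w.2 : ℝ) ≠ 0 := by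
      have : w.2 ≠ 0 := by omega
      exact_mod_cast this
    simp [dotZ, this, sub_ne_zero.mpr hb])
  have hd' : fderiv ℝ (phi μ) a (0, 1) = 0 := hd
  rw [e, map_smul, hd'] at h
  simpa using h

lemma phi₀_le {μ μ₀ : Zd d → ℝ} (hp : ∀ z, 0 ≤ μ z) (hp₀ : ∀ z, 0 ≤ μ₀ z) (h2 : H2 μ)
    (h3 : H3 μ) (h3' : H3 μ₀) {t : ℝ} {a : Rd d} (hat : phi μ a = t)
    (hd : dBeta (phi μ) a = 0) (hΘ : a.1 ∈ Theta μ μ₀ t) : phi μ₀ a ≤ t := by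
  by_contra hc
  rw [not_le] at hc
  have hline : Continuous fun b : ℝ => phi μ₀ (a.1, b) :=
    (phi_continuous hp₀ h3').comp (by fun_prop)
  obtain ⟨m, hm1, hm2⟩ := exists_between hc
  have hev : ∀ᶠ b in nhds a.2, m < phi μ₀ (a.1, b) :=
    hline.continuousAt.eventually_const_lt (by simpa using hm2)
  obtain ⟨δ, hδ, hball⟩ := Metric.eventually_nhds_iff.mp hev
  set r := δ / 2 with hr
  have hr0 : 0 < r := by positivity
  have p1 := vert_strict hp h2 h3 hd (b := a.2 + r) (by linarith)
  have p2 := vert_strict hp h2 h3 hd (b := a.2 - r) (by linarith)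
  set m' := min m (min (phi μ (a.1, a.2 + r)) (phi μ (a.1, a.2 - r))) with hm'
  have hm't : t < m' := by
    rw [hat] at p1 p2
    exact lt_min hm1 (lt_min p1 p2)
  have hall : ∀ b : ℝ, m' ≤ max (phi μ (a.1, b)) (phi μ₀ (a.1, b)) := by
    intro b
    by_cases hb : |b - a.2| ≤ r
    · refine le_max_of_le_right ((min_le_left _ _).trans (hball ?_).le)
      rw [Real.dist_eq]; linarith
    · rw [not_le] at hb
      refine le_max_of_le_left ((min_le_right _ _).trans ?_)
      have hb0 : 0 < |b - a.2| := hr0.trans hb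
      set θ := r / |b - a.2| with hθ
      have hθ0 : 0 ≤ θ := by positivity
      have hθ1 : θ ≤ 1 := (div_le_one hb0).mpr hb.le
      have hcv := phi_convex hp h3 a (a.1, b) θ hθ0 hθ1
      have hab : phi μ a ≤ phi μ (a.1, b) := by
        refine (vert_strict hp h2 h3 hd ?_).le
        intro h; rw [h, sub_self, abs_zero] at hb0; exact lt_irrefl _ hb0
      have hle : phi μ ((1 - θ) • a + θ • ((a.1, b) : Rd d)) ≤ phi μ (a.1, b) := by
        nlinarith
      have heq : (1 - θ) • a + θ • ((a.1, b) : Rd d) = (a.1, a.2 + θ * (b - a.2)) := by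
        refine Prod.ext ?_ ?_
        · funext i; simp; ring
        · simp; ring
      rw [heq] at hle
      rcases abs_cases (b - a.2) with ⟨h, _⟩ | ⟨h, _⟩
      · have : θ * (b - a.2) = r := by rw [← h, hθ]; field_simp
        rw [this] at hle
        exact (min_le_left _ _).trans hle
      · have : θ * (b - a.2) = -r := by
          have h' : b - a.2 = -|b - a.2| := by linarith
          rw [h', mul_neg, hθ, div_mul_cancel₀ _ hb0.ne']
        rw [this, ← sub_eq_add_neg] at hle
        exact (min_le_right _ _).trans hle
  have : m' ≤ t := by
    refine le_trans (le_csInf (Set.range_nonempty _) ?_) hΘ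
    rintro _ ⟨b, rfl⟩
    exact hall b
  linarith

lemma dBeta_phi₀_pos {μ₀ : Zd d → ℝ} (hp₀ : ∀ z, 0 ≤ μ₀ z) (h3' : H3 μ₀)
    (h0 : ∀ z : Zd d, z.2 < 0 → μ₀ z = 0) (hup : ∃ w : Zd d, 0 < μ₀ w ∧ 1 ≤ w.2) (a : Rd d) :
    0 < fderiv ℝ (phi μ₀) a (0, 1) := by
  obtain ⟨w, hw, hw2⟩ := hup
  have hdz : ∀ z : Zd d, dotZ ((0, 1) : Rd d) z = (z.2 : ℝ) := by intro z; simp [dotZ]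
  have hs := hasSum_fderiv hp₀ h3' a (0, 1)
  refine hasSum_lt (i := w) (fun z => ?_) ?_ hasSum_zero hs
  · simp only [hdz]
    by_cases hz : z.2 < 0
    · simp [h0 z hz]
    · have : (0 : ℝ) ≤ z.2 := by exact_mod_cast not_lt.mp hz
      exact mul_nonneg (mul_nonneg (hp₀ z) (Real.exp_pos _).le) this
  · simp only [hdz]
    have : (0 : ℝ) < w.2 := by
      have : 0 < w.2 := by omega
      exact_mod_cast this
    exact mul_pos (mul_pos hw (Real.exp_pos _)) this

lemma tendsto_line (a v : Rd d) :
    Tendsto (fun s : ℝ => a + s • v) (nhdsWithin 0 (Set.Ioi 0)) (nhds a) := by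
  have : Continuous fun s : ℝ => a + s • v := by fun_prop
  have h := this.tendsto 0
  simp only [zero_smul, add_zero] at h
  exact h.mono_left nhdsWithin_le_nhds

/-- If `φ₀(a) ≤ t` and the vertical derivative of `φ` vanishes at `a`. -/
lemma theta_case_zero {μ μ₀ : Zd d → ℝ} (hp : ∀ z, 0 ≤ μ z) (hp₀ : ∀ z, 0 ≤ μ₀ z)
    (h3 : H3 μ) (h3' : H3 μ₀) {t : ℝ} {a : Rd d} (hat : phi μ a = t)
    (hd : dBeta (phi μ) a = 0) (h0a : phi μ₀ a ≤ t)
    (hpos : 0 < fderiv ℝ (phi μ₀) a (0, 1)) (v : Rd d) (hv : fderiv ℝ (phi μ) a v < 0) :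
    ∀ᶠ s : ℝ in nhdsWithin 0 (Set.Ioi 0), (a + s • v).1 ∈ Theta μ μ₀ t := by
  set p := fderiv ℝ (phi μ₀) a (0, 1) with hpdef
  set k := fderiv ℝ (phi μ₀) a v with hk
  set m := (|k| + 1) / p with hm
  set u : Rd d := v - m • ((0, 1) : Rd d) with hu
  have hd' : fderiv ℝ (phi μ) a (0, 1) = 0 := hd
  have e1 : fderiv ℝ (phi μ) a u < 0 := by
    rw [hu, map_sub, map_smul, hd']; simpa using hv
  have e2 : fderiv ℝ (phi μ₀) a u < 0 := by
    rw [hu, map_sub, map_smul, ← hpdef, ← hk, smul_eq_mul, hm, div_mul_cancel₀ _ hpos.ne']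
    linarith [le_abs_self k]
  filter_upwards [descent hp h3 a u e1, descent hp₀ h3' a u e2] with s hs1 hs2
  have hfst : (a + s • v).1 = (a + s • u).1 := by simp [hu]
  rw [hfst]
  exact mem_Theta hp (a + s • u).2 (by rw [hat] at hs1; exact hs1.le) (hs2.le.trans h0a)

lemma theta_case_pos {μ μ₀ : Zd d → ℝ} (hp : ∀ z, 0 ≤ μ z) (hp₀ : ∀ z, 0 ≤ μ₀ z)
    (h2 : H2 μ) (h3 : H3 μ) (h3' : H3 μ₀) {t : ℝ} {a : Rd d} (hat : phi μ a = t)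
    (hd : 0 < dBeta (phi μ) a) (hbar : phi μ₀ (abar μ t a) < t) (v : Rd d) :
    ∀ᶠ s : ℝ in nhdsWithin 0 (Set.Ioi 0), (a + s • v).1 ∈ Theta μ μ₀ t := by
  obtain ⟨_, hb2⟩ := betaBar_spec hp h2 h3 hat.le
  have hneg : fderiv ℝ (phi μ) a (-(0, 1)) < 0 := by
    rw [map_neg]; unfold dBeta at hd; linarith
  obtain ⟨s₀, hs₀⟩ := (descent hp h3 a _ hneg).exists
  set c : Rd d := a + s₀ • (-(0, 1)) with hc
  have hc1 : c.1 = a.1 := by simp [hc]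
  rw [hat] at hs₀
  have hpt : ∀ᶠ r : ℝ in nhdsWithin 0 (Set.Ioi 0),
      phi μ₀ (abar μ t a + r • (c - abar μ t a)) < t :=
    (tendsto_line (abar μ t a) (c - abar μ t a)).eventually
      ((phi_continuous hp₀ h3').continuousAt.eventually_lt_const hbar)
  have hlt1 : ∀ᶠ r : ℝ in nhdsWithin 0 (Set.Ioi 0), r < 1 :=
    nhdsWithin_le_nhds (eventually_lt_nhds one_pos)
  obtain ⟨r, hr0, hr1, hr2⟩ :=
    (hpt.and (hlt1.and (self_mem_nhdsWithin : Set.Ioi (0 : ℝ) ∈ nhdsWithin 0 (Set.Ioi 0)))).exists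
  have hr2' : 0 < r := hr2
  set e : Rd d := abar μ t a + r • (c - abar μ t a) with he
  have he' : e = (1 - r) • abar μ t a + r • c := by rw [he]; module
  have hphie : phi μ e < t := by
    have := phi_convex hp h3 (abar μ t a) c r hr2'.le hr1.le
    rw [← he'] at this
    nlinarith
  have he1 : e.1 = a.1 := by
    rw [he]; simp [hc1, abar]
  have hev1 := (tendsto_line e v).eventually
    ((phi_continuous hp h3).continuousAt.eventually_lt_const hphie)
  have hev2 := (tendsto_line e v).eventually
    ((phi_continuous hp₀ h3').continuousAt.eventually_lt_const hr0)
  filter_upwards [hev1, hev2] with s k1 k2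
  have hfst : (a + s • v).1 = (e + s • v).1 := by simp [he1]
  rw [hfst]
  exact mem_Theta hp (e + s • v).2 k1.le k2.le

/-- Lemma 2, first case: under (H0)-(H3), for `t > ρ(P)` and
`a ∈ Γ₊^t` with either `φ₀(ā^t) < t` or `a = ā^t ∈ ∂₀D^t`, the normal cone to `Ĥ^t`
at `a` is the ray generated by `∇φ(a)`. -/
theorem normal_cone_ray {d : ℕ} (μ μ₀ : Zd d → ℝ)
    (hμ : IsMeasure μ) (hμ₀ : IsMeasure μ₀)
    (h0 : H0 μ μ₀) (h1 : H1 μ μ₀) (h2 : H2 μ) (h3 : H3 μ) (h3' : H3 μ₀)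
    (t : ℝ) (ht : rho μ μ₀ < t)
    (a : Rd d) (ha : a ∈ GammaPlus μ μ₀ t)
    (hcase : phi μ₀ (abar μ t a) < t ∨ (a = abar μ t a ∧ a ∈ dZero μ t)) :
    Vcone μ μ₀ t a = {v : Rd d | ∃ c : ℝ, 0 ≤ c ∧ v = c • gradV (phi μ) a} := by
  have hp := hμ.1
  have hp₀ := hμ₀.1
  obtain ⟨⟨hΘ, hle⟩, hfr, hdn⟩ := ha
  have hat : phi μ a = t := by
    refine le_antisymm hle (not_lt.mp fun hlt => hfr.2 ?_)
    refine interior_mono (s := {x | phi μ x < t}) (fun x (hx : phi μ x < t) => hx.le) ?_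
    rw [(isOpen_lt (phi_continuous hp h3) continuous_const).interior_eq]
    exact hlt
  have hne := fderiv_ne_zero hμ hμ₀ h0 h1 h2 h3 ht a hat
  ext q
  constructor
  · intro hq
    refine farkas (phi μ) a q hne fun v hv => ?_
    have hTh : ∀ᶠ s : ℝ in nhdsWithin 0 (Set.Ioi 0), (a + s • v).1 ∈ Theta μ μ₀ t := by
      rcases hdn.eq_or_lt with hz | hpos
      · exact theta_case_zero hp hp₀ h3 h3' hat hz.symm
          (phi₀_le hp hp₀ h2 h3 h3' hat hz.symm hΘ)
          (dBeta_phi₀_pos hp₀ h3' h0.2 (exists_up₀ hμ hμ₀ h1) a) v hv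
      · rcases hcase with hc | ⟨_, hc⟩
        · exact theta_case_pos hp hp₀ h2 h3 h3' hat hpos hc v
        · exact absurd hc.2 hpos.ne'
    obtain ⟨s, hs1, hs2, hs3⟩ := (hTh.and ((descent hp h3 a v hv).and
      (self_mem_nhdsWithin : Set.Ioi (0 : ℝ) ∈ nhdsWithin 0 (Set.Ioi 0)))).exists
    have := hq (a + s • v) ⟨hs1, by rw [hat] at hs2; exact hs2.le⟩
    rw [add_sub_cancel_left, dotR_smul] at this
    exact nonpos_of_mul_nonpos_right this hs3
  · rintro ⟨c, hc, rfl⟩ a' ha'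
    rw [dotR_smul_left, dotR_gradV]
    have h5 := phi_tangent hp h3 a a'
    have h6 := ha'.2
    exact mul_nonpos_of_nonneg_of_nonpos hc (by linarith)
end RWHalfspace
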